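/- Let 2 ≤ ℓ ≤ m−2. Then there exists a hyperplane Π of the Plücker projective space P(⋀^ℓ V) such that |Π ∩ G(ℓ,V)| = e'(ℓ,m) = [m ℓ]_q − q^{ℓ(m−ℓ)} − q^{ℓ(m−ℓ)−2}. -/

import Mathlib

open Module

/-- The Gaussian binomial coefficient `[m ℓ]_q`, as a rational number. -/
noncomputable def gaussBinom (q m l : ℕ) : ℚ :=
  ∏ i ∈ Finset.range l, ((q : ℚ) ^ (m - i) - 1) / ((q : ℚ) ^ (i + 1) - 1)

/-- `e(ℓ,m) = [m ℓ]_q − q^{ℓ(m−ℓ)}`. -/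
noncomputable def eG (q l m : ℕ) : ℚ :=
  gaussBinom q m l - (q : ℚ) ^ (l * (m - l))

/-- `e'(ℓ,m) = [m ℓ]_q − q^{ℓ(m−ℓ)} − q^{ℓ(m−ℓ)−2}`. -/
noncomputable def eG' (q l m : ℕ) : ℚ :=
  gaussBinom q m l - (q : ℚ) ^ (l * (m - l)) - (q : ℚ) ^ (l * (m - l) - 2)

variable (F : Type*) [Field F] (V : Type*) [AddCommGroup V] [Module F V]

/-- The wedge product `v₁ ∧ ⋯ ∧ vₙ` as an element of the `n`-th exterior power. -/
noncomputable def wedge (n : ℕ) (v : Fin n → V) : ⋀[F]^n V :=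
  ⟨ExteriorAlgebra.ιMulti F n v, ExteriorAlgebra.ιMulti_range F n (Set.mem_range_self v)⟩

/-- The product `w₁ ∧ ⋯ ∧ w_k ∧ x` for `x` in the `l`-th exterior power, landing in the
`n`-th exterior power, where `k + l = n`. -/
noncomputable def mulWedge (k l n : ℕ) (h : k + l = n) (w : Fin k → V) (x : ⋀[F]^l V) :
    ⋀[F]^n V :=
  ⟨ExteriorAlgebra.ιMulti F k w * (x : ExteriorAlgebra F V), by
    subst h
    have hmem : ExteriorAlgebra.ιMulti F k w * (x : ExteriorAlgebra F V) ∈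
        (LinearMap.range (ExteriorAlgebra.ι F : V →ₗ[F] ExteriorAlgebra F V)) ^ k *
          (LinearMap.range (ExteriorAlgebra.ι F : V →ₗ[F] ExteriorAlgebra F V)) ^ l :=
      Submodule.mul_mem_mul (ExteriorAlgebra.ιMulti_range F k (Set.mem_range_self w)) x.2
    rw [← pow_add] at hmem
    exact hmem⟩

/-- An `ℓ`-dimensional subspace `L` of `V` lies on the hyperplane of the Plücker projective
space determined by the nonzero functional `φ : ⋀[F]^ℓ V →ₗ[F] F` if
`φ (ω₁ ∧ ⋯ ∧ ω_ℓ) = 0` for some (equivalently, every) basis `ω₁, …, ω_ℓ` of `L`. -/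
def LiesOn (l : ℕ) (φ : ⋀[F]^l V →ₗ[F] F) (L : Submodule F V) : Prop :=
  ∃ ω : Fin l → V, (∀ i, ω i ∈ L) ∧ LinearIndependent F ω ∧
    Submodule.span F (Set.range ω) = L ∧ φ (wedge F V l ω) = 0

/-- The hyperplane determined by `φ : ⋀[F]^ℓ V →ₗ[F] F` is decomposable if there exist vectors
`w₁, …, w_{m−ℓ} ∈ V` and a nonzero linear functional `ψ : ⋀[F]^m V →ₗ[F] F` such that
`φ x = ψ (w₁ ∧ ⋯ ∧ w_{m−ℓ} ∧ x)` for all `x ∈ ⋀[F]^ℓ V`. -/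
def IsDecomposable (m l : ℕ) (h : l ≤ m) (φ : ⋀[F]^l V →ₗ[F] F) : Prop :=
  ∃ (w : Fin (m - l) → V) (ψ : ⋀[F]^m V →ₗ[F] F), ψ ≠ 0 ∧
    ∀ x : ⋀[F]^l V, φ x = ψ (mulWedge F V (m - l) l m (Nat.sub_add_cancel h) w x)

theorem Nat.card_subtype_prod_of_fiber {A B : Type*} [Finite A] [Finite B] (Q : A → Prop)
    (P : A → B → Prop) {c d : ℕ} (hd : Nat.card {a // Q a} = d)
    (hc : ∀ a, Q a → Nat.card {b // P a b} = c) :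
    Nat.card {p : A × B // Q p.1 ∧ P p.1 p.2} = d * c := by
  classical
  let e : {p : A × B // Q p.1 ∧ P p.1 p.2} ≃ Σ a : {a // Q a}, {b // P a.1 b} :=
    { toFun := fun p => ⟨⟨p.1.1, p.2.1⟩, ⟨p.1.2, p.2.2⟩⟩
      invFun := fun s => ⟨(s.1.1, s.2.1), s.1.2, s.2.2⟩
      left_inv := fun _ => rfl
      right_inv := fun _ => rfl }
  have : Fintype {a // Q a} := Fintype.ofFinite _
  rw [Nat.card_congr e, Nat.card_sigma, Finset.sum_congr rfl fun a _ => hc a.1 a.2, ← hd]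
  simp

theorem Nat.card_subtype_add_card_subtype_not {A : Type*} [Finite A] (P : A → Prop) :
    Nat.card {a // P a} + Nat.card {a // ¬ P a} = Nat.card A := by
  classical
  rw [← Nat.card_sum, Nat.card_congr (Equiv.sumCompl P)]

section FiniteField

variable {F : Type*} [Field F] [Fintype F]

theorem LinearMap.card_apply_ne_zero {W : Type*} [AddCommGroup W] [Module F W]
    [FiniteDimensional F W] {f : W →ₗ[F] F} (hf : f ≠ 0) :
    Nat.card {x // f x ≠ 0} =
      Fintype.card F ^ finrank F W - Fintype.card F ^ (finrank F W - 1) := by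
  have : Finite W := Module.finite_of_finite F
  have h := Nat.card_subtype_add_card_subtype_not fun x => f x = 0
  have hk : Nat.card {x // f x = 0} = Fintype.card F ^ (finrank F W - 1) := by
    have h1 : finrank F (LinearMap.range f) = 1 := by
      rw [LinearMap.range_eq_top.2 (LinearMap.surjective hf), finrank_top, finrank_self]
    have h2 := f.finrank_range_add_finrank_ker
    change Nat.card (LinearMap.ker f) = _
    rw [Module.natCard_eq_pow_finrank (K := F), Nat.card_eq_fintype_card (α := F)]
    congr 1
    omega
  rw [Module.natCard_eq_pow_finrank (K := F) (V := W), Nat.card_eq_fintype_card (α := F)] at h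
  simp only [ne_eq]
  omega

/-- Each subspace of dimension `l` has `∏ i < l, (q ^ l - q ^ i)` ordered bases. -/
theorem Submodule.card_mul_card_bases {V : Type*} [AddCommGroup V] [Module F V]
    [FiniteDimensional F V] (l : ℕ) (P : Submodule F V → Prop) :
    Nat.card {L : Submodule F V // finrank F L = l ∧ P L} *
        ∏ i : Fin l, (Fintype.card F ^ l - Fintype.card F ^ (i : ℕ)) =
      Nat.card {w : Fin l → V // LinearIndependent F w ∧ P (Submodule.span F (Set.range w))} := by
  have : Finite V := Module.finite_of_finite F
  have : Finite (Submodule F V) := Finite.of_injective _ (SetLike.coe_injective (A := Submodule F V))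
  rw [← Nat.card_subtype_prod_of_fiber (B := Fin l → V) (fun L : Submodule F V => finrank F L = l ∧ P L)
    (fun L w => LinearIndependent F w ∧ Submodule.span F (Set.range w) = L) rfl]
  · refine Nat.card_congr
      { toFun := fun p => ⟨p.1.2, p.2.2.1, by rw [p.2.2.2]; exact p.2.1.2⟩
        invFun := fun w => ⟨(Submodule.span F (Set.range w.1), w.1),
          ⟨by simpa using finrank_span_eq_card w.2.1, w.2.2⟩, w.2.1, rfl⟩
        left_inv := fun p => Subtype.ext (Prod.ext p.2.2.2 rfl)
        right_inv := fun _ => rfl }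
  · rintro L ⟨hL, -⟩
    have := card_linearIndependent (K := F) (V := L) (k := l) hL.ge
    rw [hL] at this
    rw [← this]
    refine Nat.card_congr
      { toFun := fun w => ⟨fun i => ⟨w.1 i, w.2.2.le (Submodule.subset_span (Set.mem_range_self i))⟩,
          LinearIndependent.of_comp L.subtype w.2.1⟩
        invFun := fun v => ⟨fun i => (v.1 i : V), v.2.map' L.subtype L.ker_subtype, ?_⟩
        left_inv := fun _ => rfl
        right_inv := fun _ => rfl }
    refine Submodule.eq_of_le_of_finrank_eq
      (Submodule.span_le.2 (Set.range_subset_iff.2 fun i => (v.1 i).2)) ?_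
    exact (finrank_span_eq_card (v.2.map' L.subtype L.ker_subtype)).trans
      ((Fintype.card_fin l).trans hL.symm)

end FiniteField

theorem AlternatingMap.eq_zero_iff_of_span_eq {F V : Type*} [Field F] [AddCommGroup V]
    [Module F V] {l : ℕ} (f : V [⋀^Fin l]→ₗ[F] F) {v w : Fin l → V} (hv : LinearIndependent F v)
    (hw : ∀ i, w i ∈ Submodule.span F (Set.range v)) (h : f v = 0) : f w = 0 := by
  have h1 := (f.compLinearMap (Submodule.span F (Set.range v)).subtype).eq_smul_basis_det
    (Basis.span hv)
  have h2 := congr_arg (fun g => g fun i => ⟨w i, hw i⟩) h1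
  have h3 : (fun i => ((Basis.span hv i : Submodule.span F (Set.range v)) : V)) = v :=
    funext fun i => congr_arg Subtype.val (Basis.span_apply hv i)
  simpa [AlternatingMap.compLinearMap_apply, h3, h] using h2

section TwoMinors

variable {F : Type*} [Field F] {n k : ℕ}

/-- The determinant of the square matrix with rows `b`, `a` and the rows of `C`, as a linear
function of `b`. -/
noncomputable def Matrix.detConsCons (C : Fin n → Fin (n + 2) → F) (a : Fin (n + 2) → F) :
    (Fin (n + 2) → F) →ₗ[F] F where
  toFun b := Matrix.detRowAlternating.curryLeft b (Fin.cons a C)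
  map_add' _ _ := by simp
  map_smul' _ _ := by simp

theorem Matrix.detConsCons_apply (C : Fin n → Fin (n + 2) → F) (a b : Fin (n + 2) → F) :
    Matrix.detConsCons C a b =
      Matrix.det (Matrix.of (Fin.cons b (Fin.cons a C) : Fin (n + 2) → Fin (n + 2) → F)) := rfl

theorem Matrix.detConsCons_ne_zero_iff (C : Fin n → Fin (n + 2) → F) (a : Fin (n + 2) → F) :
    Matrix.detConsCons C a ≠ 0 ↔
      LinearIndependent F C ∧ a ∉ Submodule.span F (Set.range C) := by
  have key : ∀ b, Matrix.detConsCons C a b ≠ 0 ↔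
      (LinearIndependent F C ∧ a ∉ Submodule.span F (Set.range C)) ∧
        b ∉ Submodule.span F (Set.range (Fin.cons a C : Fin (n + 1) → Fin (n + 2) → F)) := by
    intro b
    rw [← linearIndependent_finCons, ← linearIndependent_finCons, Matrix.detConsCons_apply,
      ← isUnit_iff_ne_zero, ← Matrix.isUnit_iff_isUnit_det,
      ← Matrix.linearIndependent_rows_iff_isUnit]
    rfl
  constructor
  · intro h
    obtain ⟨b, hb⟩ := DFunLike.ne_iff.1 h
    exact ((key b).1 hb).1
  · intro h
    have hlt : finrank F (Submodule.span F
        (Set.range (Fin.cons a C : Fin (n + 1) → Fin (n + 2) → F))) <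
        finrank F (Fin (n + 2) → F) := by
      rw [finrank_span_eq_card (linearIndependent_finCons.2 h)]
      simp
    obtain ⟨b, -, hb⟩ := SetLike.exists_of_lt (Submodule.lt_top_of_finrank_lt_finrank hlt)
    exact DFunLike.ne_iff.2 ⟨b, (key b).2 ⟨h, hb⟩⟩

/-- The number of column systems on which the sum of two determinants sharing the columns `C`
does not vanish. -/
theorem Matrix.card_detConsCons_add_ne_zero [Fintype F] (n k : ℕ) :
    Nat.card {p : (Fin n → Fin (n + 2) → F) × ((Fin (n + 2) → F) × (Fin (n + 2) → F)) ×
        ((Fin (n + 2) → F) × (Fin (n + 2) → F)) × (Fin k → Fin (n + 2) → F) //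
        Matrix.detConsCons p.1 p.2.1.1 p.2.2.1.1 + Matrix.detConsCons p.1 p.2.1.2 p.2.2.1.2 ≠ 0} =
      (∏ i : Fin n, (Fintype.card F ^ (n + 2) - Fintype.card F ^ (i : ℕ))) *
        ((Fintype.card F ^ (2 * (n + 2)) - Fintype.card F ^ (2 * n)) *
        ((Fintype.card F ^ (2 * (n + 2)) - Fintype.card F ^ (2 * (n + 2) - 1)) *
          Fintype.card F ^ ((n + 2) * k))) := by
  let g (C : Fin n → Fin (n + 2) → F) (ac : (Fin (n + 2) → F) × (Fin (n + 2) → F)) :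
      (Fin (n + 2) → F) × (Fin (n + 2) → F) →ₗ[F] F :=
    (Matrix.detConsCons C ac.1).coprod (Matrix.detConsCons C ac.2)
  have hg : ∀ C ac, g C ac ≠ 0 ↔ LinearIndependent F C ∧
      ¬ (ac.1 ∈ Submodule.span F (Set.range C) ∧ ac.2 ∈ Submodule.span F (Set.range C)) := by
    intro C ac
    have h0 : g C ac = 0 ↔ Matrix.detConsCons C ac.1 = 0 ∧ Matrix.detConsCons C ac.2 = 0 := by
      constructor
      · intro h
        constructor <;> refine LinearMap.ext fun x => ?_
        · simpa [g] using LinearMap.congr_fun h (x, 0)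
        · simpa [g] using LinearMap.congr_fun h (0, x)
      · rintro ⟨h1, h2⟩
        exact LinearMap.ext fun x => by simp [g, h1, h2]
    have h1 := Matrix.detConsCons_ne_zero_iff C ac.1
    have h2 := Matrix.detConsCons_ne_zero_iff C ac.2
    tauto
  have hiff : ∀ p : (Fin n → Fin (n + 2) → F) × ((Fin (n + 2) → F) × (Fin (n + 2) → F)) ×
        ((Fin (n + 2) → F) × (Fin (n + 2) → F)) × (Fin k → Fin (n + 2) → F),
      Matrix.detConsCons p.1 p.2.1.1 p.2.2.1.1 + Matrix.detConsCons p.1 p.2.1.2 p.2.2.1.2 ≠ 0 ↔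
      LinearIndependent F p.1 ∧ (¬ (p.2.1.1 ∈ Submodule.span F (Set.range p.1) ∧
        p.2.1.2 ∈ Submodule.span F (Set.range p.1)) ∧ (g p.1 p.2.1 p.2.2.1 ≠ 0 ∧ True)) := by
    intro p
    rw [← and_assoc, ← hg, and_true]
    exact ⟨fun h => ⟨fun h0 => h (LinearMap.congr_fun h0 p.2.2.1), h⟩, fun h => h.2⟩
  have hU : finrank F (Fin (n + 2) → F) = n + 2 := by simp
  rw [Nat.card_congr (Equiv.subtypeEquivRight hiff)]
  refine Nat.card_subtype_prod_of_fiber (fun C => LinearIndependent F C)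
    (fun C (r : ((Fin (n + 2) → F) × (Fin (n + 2) → F)) ×
      ((Fin (n + 2) → F) × (Fin (n + 2) → F)) × (Fin k → Fin (n + 2) → F)) =>
      ¬ (r.1.1 ∈ Submodule.span F (Set.range C) ∧ r.1.2 ∈ Submodule.span F (Set.range C)) ∧
        (g C r.1 r.2.1 ≠ 0 ∧ True)) ?_ fun C hC => ?_
  · have := card_linearIndependent (K := F) (V := Fin (n + 2) → F) (k := n) (by simp)
    rw [hU] at this
    exact this
  refine Nat.card_subtype_prod_of_fiber (fun r : (Fin (n + 2) → F) × (Fin (n + 2) → F) =>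
    ¬ (r.1 ∈ Submodule.span F (Set.range C) ∧ r.2 ∈ Submodule.span F (Set.range C)))
    (fun r (s : ((Fin (n + 2) → F) × (Fin (n + 2) → F)) × (Fin k → Fin (n + 2) → F)) =>
      g C r s.1 ≠ 0 ∧ True) ?_ fun r hr => ?_
  · have h := Nat.card_subtype_add_card_subtype_not
      fun r : (Fin (n + 2) → F) × (Fin (n + 2) → F) =>
        r.1 ∈ Submodule.span F (Set.range C) ∧ r.2 ∈ Submodule.span F (Set.range C)
    have hs : Nat.card {r : (Fin (n + 2) → F) × (Fin (n + 2) → F) //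
        r.1 ∈ Submodule.span F (Set.range C) ∧ r.2 ∈ Submodule.span F (Set.range C)} =
        Fintype.card F ^ (2 * n) := by
      have e := Nat.card_congr (Equiv.subtypeProdEquivProd
        (p := fun a => a ∈ Submodule.span F (Set.range C))
        (q := fun a => a ∈ Submodule.span F (Set.range C)))
      rw [e, Nat.card_prod]
      change Nat.card (Submodule.span F (Set.range C)) *
        Nat.card (Submodule.span F (Set.range C)) = _
      rw [Module.natCard_eq_pow_finrank (K := F), finrank_span_eq_card hC, ← pow_add,
        Fintype.card_fin, two_mul, Nat.card_eq_fintype_card (α := F)]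
    rw [hs, Module.natCard_eq_pow_finrank (K := F) (V := (Fin (n + 2) → F) × (Fin (n + 2) → F)),
      Module.finrank_prod, hU, ← two_mul,
      Nat.card_eq_fintype_card (α := F)] at h
    omega
  refine Nat.card_subtype_prod_of_fiber (fun s => g C r s ≠ 0)
    (fun s (t : Fin k → Fin (n + 2) → F) => True) ?_ fun s hs => ?_
  · rw [LinearMap.card_apply_ne_zero ((hg C r).2 ⟨hC, hr⟩), Module.finrank_prod, hU, two_mul]
  · simp [← pow_mul]

/-- The alternating form `(x₁ ∧ y₁ + x₂ ∧ y₂) ∧ z₁ ∧ ⋯ ∧ zₙ` in the dual coordinates. -/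
noncomputable def AlternatingMap.twoMinors (F : Type*) [Field F] (n k : ℕ) :
    ((Fin n → F) × (F × F) × (F × F) × (Fin k → F)) [⋀^Fin (n + 2)]→ₗ[F] F :=
  Matrix.detRowAlternating.compLinearMap
    { toFun := fun x => (Fin.cons x.2.2.1.1 (Fin.cons x.2.1.1 x.1) : Fin (n + 2) → F)
      map_add' := fun _ _ => by
        ext j; refine Fin.cases rfl (fun j => Fin.cases rfl (fun _ => rfl) j) j
      map_smul' := fun _ _ => by
        ext j; refine Fin.cases rfl (fun j => Fin.cases rfl (fun _ => rfl) j) j } +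
  Matrix.detRowAlternating.compLinearMap
    { toFun := fun x => (Fin.cons x.2.2.1.2 (Fin.cons x.2.1.2 x.1) : Fin (n + 2) → F)
      map_add' := fun _ _ => by
        ext j; refine Fin.cases rfl (fun j => Fin.cases rfl (fun _ => rfl) j) j
      map_smul' := fun _ _ => by
        ext j; refine Fin.cases rfl (fun j => Fin.cases rfl (fun _ => rfl) j) j }

theorem AlternatingMap.twoMinors_apply
    (w : Fin (n + 2) → (Fin n → F) × (F × F) × (F × F) × (Fin k → F)) :
    AlternatingMap.twoMinors F n k w =
      Matrix.detConsCons (fun j i => (w i).1 j) (fun i => (w i).2.1.1) (fun i => (w i).2.2.1.1) +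
      Matrix.detConsCons (fun j i => (w i).1 j) (fun i => (w i).2.1.2)
        (fun i => (w i).2.2.1.2) := by
  rw [Matrix.detConsCons_apply, Matrix.detConsCons_apply, ← Matrix.det_transpose,
    ← Matrix.det_transpose (Matrix.of _)]
  refine congr_arg₂ (fun x y : F => x + y) (congr_arg Matrix.det ?_) (congr_arg Matrix.det ?_) <;>
  · ext i j
    refine Fin.cases rfl (fun j => Fin.cases rfl (fun _ => rfl) j) j

theorem AlternatingMap.card_twoMinors_ne_zero [Fintype F] (n k : ℕ) :
    Nat.card {w // AlternatingMap.twoMinors F n k w ≠ 0} =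
      (∏ i : Fin n, (Fintype.card F ^ (n + 2) - Fintype.card F ^ (i : ℕ))) *
        ((Fintype.card F ^ (2 * (n + 2)) - Fintype.card F ^ (2 * n)) *
        ((Fintype.card F ^ (2 * (n + 2)) - Fintype.card F ^ (2 * (n + 2) - 1)) *
          Fintype.card F ^ ((n + 2) * k))) := by
  rw [← Matrix.card_detConsCons_add_ne_zero]
  refine Nat.card_congr (Equiv.subtypeEquiv
    { toFun := fun w => (fun j i => (w i).1 j,
        (fun i => (w i).2.1.1, fun i => (w i).2.1.2),
        (fun i => (w i).2.2.1.1, fun i => (w i).2.2.1.2), fun j i => (w i).2.2.2 j)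
      invFun := fun p i => (fun j => p.1 j i, (p.2.1.1 i, p.2.1.2 i),
        (p.2.2.1.1 i, p.2.2.1.2 i), fun j => p.2.2.2 j i)
      left_inv := fun _ => rfl
      right_inv := fun _ => rfl } fun w => ?_)
  rw [AlternatingMap.twoMinors_apply]
  rfl

theorem AlternatingMap.card_twoMinors_compLinearMap_ne_zero [Fintype F] {V : Type*}
    [AddCommGroup V] [Module F V] (n k : ℕ)
    (e : V ≃ₗ[F] (Fin n → F) × (F × F) × (F × F) × (Fin k → F)) :
    Nat.card {w // (AlternatingMap.twoMinors F n k).compLinearMap e.toLinearMap w ≠ 0} =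
      (∏ i : Fin n, (Fintype.card F ^ (n + 2) - Fintype.card F ^ (i : ℕ))) *
        ((Fintype.card F ^ (2 * (n + 2)) - Fintype.card F ^ (2 * n)) *
        ((Fintype.card F ^ (2 * (n + 2)) - Fintype.card F ^ (2 * (n + 2) - 1)) *
          Fintype.card F ^ ((n + 2) * k))) := by
  rw [← AlternatingMap.card_twoMinors_ne_zero]
  exact Nat.card_congr (Equiv.subtypeEquiv (Equiv.piCongrRight fun _ => e.toEquiv)
    fun w => Iff.rfl)

end TwoMinors

theorem prod_pow_sub_pow_ne_zero {q : ℕ} (hq : 1 < q) {r m : ℕ} (hr : r ≤ m) :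
    (∏ i ∈ Finset.range r, ((q : ℚ) ^ m - (q : ℚ) ^ i)) ≠ 0 := by
  refine Finset.prod_ne_zero_iff.2 fun i hi => sub_ne_zero.2 fun h => ?_
  have := Nat.pow_right_injective hq (by exact_mod_cast h : q ^ m = q ^ i)
  have := Finset.mem_range.1 hi
  omega

theorem gaussBinom_mul_prod {q l m : ℕ} (hq : 1 < q) (hlm : l ≤ m) :
    gaussBinom q m l * ∏ i ∈ Finset.range l, ((q : ℚ) ^ l - (q : ℚ) ^ i) =
      ∏ i ∈ Finset.range l, ((q : ℚ) ^ m - (q : ℚ) ^ i) := by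
  have key : ∀ r, l ≤ r → ∏ i ∈ Finset.range l, ((q : ℚ) ^ r - (q : ℚ) ^ i) =
      (∏ i ∈ Finset.range l, (q : ℚ) ^ i) * ∏ i ∈ Finset.range l, ((q : ℚ) ^ (r - i) - 1) := by
    intro r hr
    rw [← Finset.prod_mul_distrib]
    refine Finset.prod_congr rfl fun i hi => ?_
    rw [mul_sub, ← pow_add, mul_one, Nat.add_sub_cancel' ((Finset.mem_range.1 hi).le.trans hr)]
  have hrefl : ∏ i ∈ Finset.range l, ((q : ℚ) ^ (l - i) - 1) =
      ∏ i ∈ Finset.range l, ((q : ℚ) ^ (i + 1) - 1) := by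
    rw [← Finset.prod_range_reflect]
    refine Finset.prod_congr rfl fun i hi => ?_
    have := Finset.mem_range.1 hi
    congr 2
    omega
  have hne : ∏ i ∈ Finset.range l, ((q : ℚ) ^ (i + 1) - 1) ≠ 0 :=
    Finset.prod_ne_zero_iff.2 fun i _ =>
      (sub_pos.2 (one_lt_pow₀ (by exact_mod_cast hq) i.succ_ne_zero)).ne'
  rw [key l le_rfl, key m hlm, hrefl, gaussBinom, Finset.prod_div_distrib]
  field_simp

theorem cast_prod_pow_sub_pow {q : ℕ} (hq : 1 < q) {r m : ℕ} (hr : r ≤ m) :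
    ((∏ i : Fin r, (q ^ m - q ^ (i : ℕ)) : ℕ) : ℚ) =
      ∏ i ∈ Finset.range r, ((q : ℚ) ^ m - (q : ℚ) ^ i) := by
  rw [Finset.prod_range, Nat.cast_prod]
  refine Finset.prod_congr rfl fun i _ => ?_
  rw [Nat.cast_sub (Nat.pow_le_pow_right hq.le (i.2.le.trans hr))]
  simp

theorem card_submodule_finrank_eq {F : Type*} [Field F] [Fintype F] {V : Type*} [AddCommGroup V]
    [Module F V] [FiniteDimensional F V] {l : ℕ} (hl : l ≤ finrank F V) :
    (Nat.card {L : Submodule F V // finrank F L = l} : ℚ) =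
      gaussBinom (Fintype.card F) (finrank F V) l := by
  have : Finite V := Module.finite_of_finite F
  have hq : 1 < Fintype.card F := Fintype.one_lt_card
  have h := Submodule.card_mul_card_bases (F := F) (V := V) l fun _ => True
  simp only [and_true] at h
  rw [card_linearIndependent hl] at h
  have h' := congr_arg (Nat.cast : ℕ → ℚ) h
  rw [Nat.cast_mul, cast_prod_pow_sub_pow hq le_rfl, cast_prod_pow_sub_pow hq hl,
    ← gaussBinom_mul_prod hq hl] at h'
  exact mul_right_cancel₀ (prod_pow_sub_pow_ne_zero hq le_rfl) h'

theorem eq_pow_add_pow_of_mul_prod_eq {q n k B : ℕ} (hq : 1 < q)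
    (h : B * ∏ i : Fin (n + 2), (q ^ (n + 2) - q ^ (i : ℕ)) =
      (∏ i : Fin n, (q ^ (n + 2) - q ^ (i : ℕ))) *
        ((q ^ (2 * (n + 2)) - q ^ (2 * n)) *
        ((q ^ (2 * (n + 2)) - q ^ (2 * (n + 2) - 1)) * q ^ ((n + 2) * k)))) :
    (B : ℚ) = (q : ℚ) ^ ((n + 2) * (k + 2)) + (q : ℚ) ^ ((n + 2) * (k + 2) - 2) := by
  have h' := congr_arg (Nat.cast : ℕ → ℚ) h
  have hne : (∏ i ∈ Finset.range (n + 2), ((q : ℚ) ^ (n + 2) - (q : ℚ) ^ i)) ≠ 0 :=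
    prod_pow_sub_pow_ne_zero hq le_rfl
  rw [Nat.cast_mul, Nat.cast_mul, cast_prod_pow_sub_pow hq le_rfl,
    cast_prod_pow_sub_pow hq (Nat.le_add_right n 2), Nat.cast_mul, Nat.cast_mul,
    Nat.cast_sub (Nat.pow_le_pow_right hq.le (by omega)),
    Nat.cast_sub (Nat.pow_le_pow_right hq.le (by omega))] at h'
  refine mul_right_cancel₀ hne (h'.trans ?_)
  rw [Finset.prod_range_succ, Finset.prod_range_succ,
    show 2 * (n + 2) - 1 = 2 * n + 3 by omega,
    show (n + 2) * (k + 2) - 2 = (n + 2) * k + 2 * n + 2 by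
      rw [mul_add]; omega]
  push_cast
  ring

theorem liesOn_zero {F V : Type*} [Field F] [AddCommGroup V] [Module F V]
    [FiniteDimensional F V] {l : ℕ} {L : Submodule F V} (hL : finrank F L = l) :
    LiesOn F V l 0 L := by
  let b := finBasisOfFinrankEq F L hL
  refine ⟨L.subtype ∘ b, fun i => (b i).2, b.linearIndependent.map' _ (Submodule.ker_subtype L),
    ?_, LinearMap.zero_apply _⟩
  rw [Set.range_comp, ← Submodule.map_span, b.span_eq, Submodule.map_subtype_top]

/-- **The second minimum weight is attained.** If `2 ≤ ℓ ≤ m−2`, then there exists a hyperplane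
`Π` of the Plücker projective space `P(⋀^ℓ V)` with
`|Π ∩ G(ℓ,V)| = e'(ℓ,m) = [m ℓ]_q − q^{ℓ(m−ℓ)} − q^{ℓ(m−ℓ)−2}`. -/
theorem stmt3 (F : Type*) [Field F] [Fintype F] (V : Type*) [AddCommGroup V] [Module F V]
    [FiniteDimensional F V] (q m l : ℕ) (hq : Fintype.card F = q)
    (hV : finrank F V = m) (hl : 2 ≤ l) (hlm : l ≤ m - 2) :
    ∃ φ : ⋀[F]^l V →ₗ[F] F, φ ≠ 0 ∧
      (Nat.card {L : Submodule F V | finrank F L = l ∧ LiesOn F V l φ L} : ℚ) =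
        eG' q l m := by
  obtain ⟨n, rfl⟩ : ∃ n, l = n + 2 := ⟨l - 2, by omega⟩
  obtain ⟨k, rfl⟩ : ∃ k, m = n + 4 + k := ⟨m - (n + 4), by omega⟩
  subst hq
  have : Finite V := Module.finite_of_finite F
  have : Finite (Submodule F V) :=
    Finite.of_injective _ (SetLike.coe_injective (A := Submodule F V))
  have hq : 1 < Fintype.card F := Fintype.one_lt_card
  let e : V ≃ₗ[F] (Fin n → F) × (F × F) × (F × F) × (Fin k → F) :=
    LinearEquiv.ofFinrankEq _ _ (by simp [hV]; omega)
  obtain ⟨f, hf⟩ : ∃ f : V [⋀^Fin (n + 2)]→ₗ[F] F, Nat.card {w // f w ≠ 0} = _ :=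
    ⟨_, AlternatingMap.card_twoMinors_compLinearMap_ne_zero n k e⟩
  obtain ⟨φ, hφ⟩ : ∃ φ : ⋀[F]^(n + 2) V →ₗ[F] F, ∀ w, φ (wedge F V (n + 2) w) = f w :=
    ⟨exteriorPower.alternatingMapLinearEquiv f,
      fun w => exteriorPower.alternatingMapLinearEquiv_apply_ιMulti f w⟩
  have hlies : ∀ w : Fin (n + 2) → V, LinearIndependent F w ∧
      ¬ LiesOn F V (n + 2) φ (Submodule.span F (Set.range w)) ↔ f w ≠ 0 := by
    intro w
    constructor
    · rintro ⟨hw, hn⟩ h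
      exact hn ⟨w, fun i => Submodule.subset_span (Set.mem_range_self i), hw, rfl,
        (hφ w).trans h⟩
    · intro h
      refine ⟨by_contra fun hw => h (f.map_linearDependent w hw), ?_⟩
      rintro ⟨v, -, hv, hs, h0⟩
      refine h (f.eq_zero_iff_of_span_eq hv (fun i => ?_) ((hφ v).symm.trans h0))
      rw [hs]
      exact Submodule.subset_span (Set.mem_range_self i)
  have hB := Submodule.card_mul_card_bases (F := F) (V := V) (n + 2)
    fun L => ¬ LiesOn F V (n + 2) φ L
  rw [Nat.card_congr (Equiv.subtypeEquivRight hlies), hf] at hB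
  have hB' := eq_pow_add_pow_of_mul_prod_eq hq hB
  have hAB := Nat.card_subtype_add_card_subtype_not
    fun L : {L : Submodule F V // finrank F L = n + 2} => LiesOn F V (n + 2) φ L
  rw [Nat.card_congr (Equiv.subtypeSubtypeEquivSubtypeInter
      (fun L : Submodule F V => finrank F L = n + 2) (LiesOn F V (n + 2) φ)),
    Nat.card_congr (Equiv.subtypeSubtypeEquivSubtypeInter
      (fun L : Submodule F V => finrank F L = n + 2) fun L => ¬ LiesOn F V (n + 2) φ L)] at hAB
  have hAB' := congr_arg (Nat.cast : ℕ → ℚ) hAB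
  rw [Nat.cast_add, hB', card_submodule_finrank_eq (by omega), hV] at hAB'
  refine ⟨φ, fun h0 => ?_, ?_⟩
  · have hempty : IsEmpty {L : Submodule F V // finrank F L = n + 2 ∧
        ¬ LiesOn F V (n + 2) φ L} := by
      rw [h0]
      exact ⟨fun L => L.2.2 (liesOn_zero L.2.1)⟩
    rw [Nat.card_of_isEmpty, Nat.cast_zero] at hB'
    have : (0 : ℚ) < Fintype.card F := by exact_mod_cast hq.le
    exact absurd hB' (by positivity)
  · rw [eG', show n + 4 + k - (n + 2) = k + 2 by omega, sub_sub]
    exact eq_sub_of_add_eq hAB'
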